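/- Let X ⊆ S^Z be a countable one-dimensional sofic shift. Then there exists a finite set T of tuples (u_0, …, u_m, v_1, …, v_m) of finite words occurring in X such that every configuration x ∈ X equals, for a unique tuple t ∈ T, a shift of a configuration of the form ∞u_0 v_1 u_1^{n_1} ⋯ u_{m-1}^{n_{m-1}} v_m u_m^∞ (a left-infinite repetition of u_0, then v_1, then n_1 copies of u_1, …, then v_m, then a right-infinite repetition of u_m) for some exponents n_1, …, n_{m-1} ∈ N. In particular, X contains only finitely many periodic configurations. -/

import Mathlib

/-- The shift map on bi-infinite configurations. -/
def shift1 {S : Type*} (x : ℤ → S) : ℤ → S := fun m => x (m + 1)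

/-- The word `u` occurs in `x` at position `n`. -/
def occursAtW {S : Type*} (u : List S) (x : ℤ → S) (n : ℤ) : Prop :=
  ∀ i : Fin u.length, x (n + ((i : ℕ) : ℤ)) = u.get i

/-- The word `u` occurs in the configuration `x`. -/
def occursW {S : Type*} (u : List S) (x : ℤ → S) : Prop := ∃ n : ℤ, occursAtW u x n

/-- The word `u` occurs in some configuration of `X`. -/
def occursWIn {S : Type*} (X : Set (ℤ → S)) (u : List S) : Prop := ∃ x ∈ X, occursW u x

/-- A one-dimensional subshift of finite type: the configurations avoiding a finite set of
forbidden words. -/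
def IsSFT1 {S : Type*} (X : Set (ℤ → S)) : Prop :=
  ∃ F : Set (List S), F.Finite ∧ X = {x | ∀ u ∈ F, ¬ occursW u x}

/-- A one-dimensional sofic shift: the image of an SFT (over some finite alphabet carrying the
discrete topology) under a block map, i.e. a continuous shift-commuting map. -/
def IsSofic1 {S : Type*} [TopologicalSpace S] (X : Set (ℤ → S)) : Prop :=
  ∃ (T : Type) (_ : Fintype T) (Y : Set (ℤ → T)) (f : (ℤ → T) → (ℤ → S)),
    IsSFT1 Y ∧
    (letI : TopologicalSpace T := ⊥
     Continuous f) ∧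
    (∀ y, f (shift1 y) = shift1 (f y)) ∧ f '' Y = X

/-- A word repeated `k` times. -/
def repWord {S : Type*} : ℕ → List S → List S
  | 0, _ => []
  | k + 1, u => u ++ repWord k u

/-- The middle word `v₁ u₁^{n₁} v₂ u₂^{n₂} ⋯ v_{m-1} u_{m-1}^{n_{m-1}}` built from the pairs
`(vⱼ, uⱼ)` and the list of exponents. -/
def midWord {S : Type*} : List (List S × List S) → List ℕ → List S
  | [], _ => []
  | _ :: _, [] => []
  | (v, u) :: ps, k :: ns => v ++ repWord k u ++ midWord ps ns

/-- The configuration `∞u . w u'∞`: a left-infinite repetition of `u`, then `w` (starting at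
the origin), then a right-infinite repetition of `u'`. -/
def glue {S : Type*} [Inhabited S] (u w u' : List S) : ℤ → S := fun i =>
  if 0 ≤ i then
    if i.toNat < w.length then w.getD i.toNat default
    else u'.getD ((i.toNat - w.length) % u'.length) default
  else u.getD (u.length - 1 - ((i.natAbs - 1) % u.length)) default

section

variable {S : Type*}

/-- The shift by an arbitrary integer. -/
def shiftBy (n : ℤ) (x : ℤ → S) : ℤ → S := fun i => x (i + n)

/-- The word `u` followed by the right-infinite ray `r`. -/
def prependWord (u : List S) (r : ℕ → S) : ℕ → S := fun i =>
  if h : i < u.length then u[i] else r (i - u.length)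

/-- The left half of `x` followed by the right-infinite ray `r`. -/
def joinRay (x : ℤ → S) (r : ℕ → S) : ℤ → S := fun i => if i < 0 then x i else r i.toNat

/-- The rays which can follow the left half of `x` in `X`. -/
def followers (X : Set (ℤ → S)) (x : ℤ → S) : Set (ℕ → S) := {r | joinRay x r ∈ X}

/-- The rays `r` such that `u` followed by `r` is in `q`. -/
def wordDeriv (q : Set (ℕ → S)) (u : List S) : Set (ℕ → S) := {r | prependWord u r ∈ q}

/-- The word of length `l` in `x` starting at position `n`. -/
def wordAt (x : ℤ → S) (n : ℤ) (l : ℕ) : List S := List.ofFn fun i : Fin l => x (n + (i : ℕ))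

/-- The periodic configuration with `u` starting at the origin. -/
def periodicConf [Inhabited S] (u : List S) : ℤ → S := fun i =>
  u.getD (i % (u.length : ℤ)).toNat default

lemma prependWord_nil (r : ℕ → S) : prependWord [] r = r := by
  funext i; simp [prependWord]

lemma prependWord_append (u v : List S) (r : ℕ → S) :
    prependWord (u ++ v) r = prependWord u (prependWord v r) := by
  funext i
  simp only [prependWord, List.length_append, List.getElem_append]
  split_ifs <;> first | rfl | omega | skip
  congr 1; omega

lemma wordDeriv_nil (q : Set (ℕ → S)) : wordDeriv q [] = q := by
  ext r; simp [wordDeriv, prependWord_nil]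

lemma wordDeriv_append (q : Set (ℕ → S)) (u v : List S) :
    wordDeriv q (u ++ v) = wordDeriv (wordDeriv q u) v := by
  ext r; simp [wordDeriv, prependWord_append]

@[simp] lemma length_wordAt (x : ℤ → S) (n : ℤ) (l : ℕ) : (wordAt x n l).length = l := by
  simp [wordAt]

lemma wordAt_add (x : ℤ → S) (n : ℤ) (l m : ℕ) :
    wordAt x n (l + m) = wordAt x n l ++ wordAt x (n + l) m := by
  apply List.ext_getElem
  · simp
  · intro i h1 h2
    simp only [wordAt, List.getElem_ofFn, List.getElem_append, List.length_ofFn]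
    split_ifs with h
    · rfl
    · congr 1; simp at h1; omega

lemma getD_wordAt [Inhabited S] (x : ℤ → S) (n : ℤ) (l j : ℕ) (h : j < l) :
    (wordAt x n l).getD j default = x (n + j) := by
  rw [List.getD_eq_getElem _ _ (by simpa using h)]
  simp [wordAt]

lemma occursW_wordAt (x : ℤ → S) (n : ℤ) (l : ℕ) : occursW (wordAt x n l) x := by
  have h : ∀ (j : ℕ) (hj : j < (wordAt x n l).length), x (n + j) = (wordAt x n l)[j] := by
    simp [wordAt]
  exact ⟨n, fun i => h i i.2⟩

lemma shiftBy_zero (x : ℤ → S) : shiftBy 0 x = x := by funext i; simp [shiftBy]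

lemma shiftBy_shiftBy (m n : ℤ) (x : ℤ → S) : shiftBy m (shiftBy n x) = shiftBy (m + n) x := by
  funext i; simp [shiftBy, add_assoc]

lemma joinRay_self (x : ℤ → S) : joinRay x (fun i => x i) = x := by
  funext i
  unfold joinRay
  split_ifs with h
  · rfl
  · exact congrArg x (Int.toNat_of_nonneg (by omega))

lemma joinRay_injective (x : ℤ → S) : Function.Injective (joinRay x) := by
  intro r r' h
  funext i
  have := congrFun h (i : ℤ)
  have hi : ¬ (i : ℤ) < 0 := by omega
  simpa [joinRay, hi] using this

lemma followers_shiftBy_add {X : Set (ℤ → S)} (hsh : ∀ n, ∀ x ∈ X, shiftBy n x ∈ X)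
    (x : ℤ → S) (n : ℤ) (l : ℕ) :
    followers X (shiftBy (n + l) x) = wordDeriv (followers X (shiftBy n x)) (wordAt x n l) := by
  have key : ∀ r, joinRay (shiftBy (n + l) x) r =
      shiftBy l (joinRay (shiftBy n x) (prependWord (wordAt x n l) r)) := by
    intro r
    funext i
    simp only [joinRay, shiftBy, prependWord, length_wordAt]
    split_ifs <;> first | omega | skip
    · congr 1; omega
    · simp only [wordAt, List.getElem_ofFn]; congr 1; omega
    · congr 1; omega
  ext r
  simp only [followers, wordDeriv, Set.mem_ofPred_eq, key]
  refine ⟨fun h => ?_, hsh _ _⟩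
  simpa [shiftBy_shiftBy, shiftBy_zero] using hsh (-l) _ h

lemma countable_followers {X : Set (ℤ → S)} (hc : X.Countable) (x : ℤ → S) :
    (followers X x).Countable :=
  hc.preimage_of_injOn (joinRay_injective x).injOn

lemma isClosed_followers [TopologicalSpace S] {X : Set (ℤ → S)} (hcl : IsClosed X) (x : ℤ → S) :
    IsClosed (followers X x) := by
  refine hcl.preimage (f := joinRay x) (continuous_pi fun i => ?_)
  unfold joinRay
  split_ifs
  · exact continuous_const
  · exact continuous_apply _

lemma nonempty_followers {X : Set (ℤ → S)} {x : ℤ → S} (hx : x ∈ X) : (followers X x).Nonempty :=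
  ⟨fun i => x i, by simpa [followers, joinRay_self] using hx⟩

/-- The infinite concatenation of the words `W (b 0)`, `W (b 1)`, … of common length `l`. -/
def blockRay [Inhabited S] (W : Bool → List S) (l : ℕ) (b : ℕ → Bool) : ℕ → S := fun i =>
  (W (b (i / l))).getD (i % l) default

lemma blockRay_eq_prependWord [Inhabited S] {W : Bool → List S} {l : ℕ} (hl : 0 < l)
    (hW : ∀ b, (W b).length = l) (b : ℕ → Bool) :
    blockRay W l b = prependWord (W (b 0)) (blockRay W l fun n => b (n + 1)) := by
  funext i
  simp only [blockRay, prependWord, hW]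
  split_ifs with h
  · rw [Nat.div_eq_of_lt h, Nat.mod_eq_of_lt h, List.getD_eq_getElem]
  · have : i = (i - l) + l := by omega
    conv_lhs => rw [this]
    rw [Nat.add_div_right _ hl, Nat.add_mod_right]

lemma blockRay_mem [Inhabited S] [TopologicalSpace S] {q : Set (ℕ → S)} (hcl : IsClosed q)
    (hne : q.Nonempty) {W : Bool → List S} {l : ℕ} (hl : 0 < l) (hW : ∀ b, (W b).length = l)
    (hq : ∀ b, wordDeriv q (W b) = q) (b : ℕ → Bool) : blockRay W l b ∈ q := by
  obtain ⟨r, hr⟩ := hne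
  have key : ∀ (k : ℕ) (b : ℕ → Bool), ∃ r' ∈ q, ∀ i < k, r' i = blockRay W l b i := by
    intro k
    induction k with
    | zero => exact fun b => ⟨r, hr, by simp⟩
    | succ k ih =>
      intro b
      obtain ⟨r', h1, h2⟩ := ih fun n => b (n + 1)
      refine ⟨prependWord (W (b 0)) r', ?_, fun i hi => ?_⟩
      · rw [← hq (b 0)] at h1; exact h1
      · rw [blockRay_eq_prependWord hl hW]
        simp only [prependWord]
        split_ifs with h
        · rfl
        · rw [hW] at h ⊢; exact h2 _ (by omega)
  choose a ha hab using fun k => key k b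
  refine hcl.mem_of_tendsto (f := a) (b := Filter.atTop) (tendsto_pi_nhds.2 fun i => ?_)
    (Filter.Eventually.of_forall ha)
  refine tendsto_const_nhds.congr' ?_
  filter_upwards [Filter.eventually_gt_atTop i] with k hk using (hab k i hk).symm

lemma blockRay_injective [Inhabited S] {W : Bool → List S} {l : ℕ} (hl : 0 < l)
    (hW : ∀ b, (W b).length = l) (hinj : Function.Injective W) :
    Function.Injective (blockRay W l) := by
  intro b b' h
  funext n
  apply hinj
  apply List.ext_getElem
  · rw [hW, hW]
  · intro i h1 h2
    have hi : i < l := by rwa [hW] at h1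
    have := congrFun h (n * l + i)
    simp only [blockRay] at this
    rw [Nat.mul_add_mod_self_right, Nat.mod_eq_of_lt hi, mul_comm, Nat.mul_add_div hl,
      Nat.div_eq_of_lt hi, add_zero, List.getD_eq_getElem _ _ h1, List.getD_eq_getElem _ _ h2]
      at this
    exact this

lemma not_countable_natBool : ¬ Countable (ℕ → Bool) := by
  rw [← Cardinal.mk_le_aleph0_iff]
  simp [Cardinal.aleph0_lt_continuum]

lemma append_comm_of_wordDeriv_eq [Inhabited S] [TopologicalSpace S] {q : Set (ℕ → S)}
    (hcl : IsClosed q) (hne : q.Nonempty) (hc : q.Countable) {u v : List S}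
    (hu : wordDeriv q u = q) (hv : wordDeriv q v = q) : u ++ v = v ++ u := by
  by_contra hne'
  let W : Bool → List S := fun b => if b then u ++ v else v ++ u
  have hW : ∀ b, (W b).length = u.length + v.length := by
    intro b; cases b <;> simp [W, add_comm]
  have hl : 0 < u.length + v.length := by
    rw [← List.length_append, List.length_pos_iff]
    intro h
    simp at h
    simp [h] at hne'
  have hinj : Function.Injective W := by
    intro b b' h
    cases b <;> cases b' <;> simp_all [W]
  have hq : ∀ b, wordDeriv q (W b) = q := by
    intro b; cases b <;> simp [W, wordDeriv_append, hu, hv]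
  have : Countable q := hc
  apply not_countable_natBool
  exact Function.Injective.countable
    (f := fun b => (⟨_, blockRay_mem hcl hne hl hW hq b⟩ : q))
    fun b b' h => blockRay_injective hl hW hinj (Subtype.ext_iff.1 h)

lemma exists_loop_generator {q : Set (ℕ → S)}
    (hcomm : ∀ u v, wordDeriv q u = q → wordDeriv q v = q → u ++ v = v ++ u) :
    ∃ w, wordDeriv q w = q ∧ ∀ v, wordDeriv q v = q → ∃ k, v = repWord k w := by
  classical
  by_cases h : ∃ n, ∃ w : List S, w ≠ [] ∧ wordDeriv q w = q ∧ w.length = n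
  · obtain ⟨w, hw0, hw, hn⟩ := Nat.find_spec h
    refine ⟨w, hw, fun v => ?_⟩
    induction hv : v.length using Nat.strong_induction_on generalizing v with
    | _ n ih =>
      intro hvq
      subst hv
      by_cases hv0 : v = []
      · exact ⟨0, by simp [repWord, hv0]⟩
      have hle : w.length ≤ v.length := by
        rw [hn]; exact Nat.find_min' h ⟨v, hv0, hvq, rfl⟩
      obtain ⟨v', rfl⟩ : w <+: v :=
        List.prefix_of_prefix_length_le (l₃ := w ++ v) (List.prefix_append _ _)
          (by rw [hcomm w v hw hvq]; exact List.prefix_append _ _) hle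
      have hpos : 0 < w.length := List.length_pos_iff.2 hw0
      obtain ⟨k, hk⟩ := ih v'.length (by simp; omega) v' rfl
        (by rwa [wordDeriv_append, hw] at hvq)
      exact ⟨k + 1, by rw [repWord, ← hk]⟩
  · push Not at h
    refine ⟨[], wordDeriv_nil q, fun v hv => ⟨0, ?_⟩⟩
    by_contra hv0
    exact h v.length v hv0 hv rfl

lemma exists_window {T S : Type*} [Finite T] [TopologicalSpace T] [DiscreteTopology T]
    [TopologicalSpace S] [DiscreteTopology S] {g : (ℤ → T) → S} (hg : Continuous g) :
    ∃ k : ℕ, ∀ y z : ℤ → T, (∀ i : ℤ, -k ≤ i → i ≤ k → y i = z i) → g y = g z := by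
  have h1 : ∀ y : ℤ → T, ∃ I : Finset ℤ, ∀ z, (∀ i ∈ I, z i = y i) → g z = g y := by
    intro y
    obtain ⟨I, u, hu, hI⟩ := isOpen_pi_iff.1 ((isOpen_discrete {g y}).preimage hg) y rfl
    refine ⟨I, fun z hz => hI fun i hi => ?_⟩
    rw [hz i hi]
    exact (hu i hi).2
  choose I hI using h1
  obtain ⟨t, -, ht⟩ := (isCompact_univ (X := ℤ → T)).elim_nhds_subcover
    (fun y => (I y : Set ℤ).pi fun i => {y i})
    (fun y _ => set_pi_mem_nhds (I y).finite_toSet fun i _ => (isOpen_discrete _).mem_nhds rfl)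
  refine ⟨(t.biUnion I).sup Int.natAbs, fun y z hyz => ?_⟩
  obtain ⟨c, hct, hc⟩ := Set.mem_iUnion₂.1 (ht (Set.mem_univ y))
  have hy : ∀ i ∈ I c, y i = c i := hc
  rw [hI c y hy, hI c z]
  intro i hi
  have : i.natAbs ≤ (t.biUnion I).sup Int.natAbs :=
    Finset.le_sup (f := Int.natAbs) (Finset.mem_biUnion.2 ⟨c, hct, hi⟩)
  rw [← hyz i (by omega) (by omega), hy i hi]

lemma shiftBy_add_one {S : Type*} (n : ℤ) (x : ℤ → S) :
    shiftBy (n + 1) x = shift1 (shiftBy n x) := by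
  funext i
  simp only [shiftBy, shift1]
  congr 1
  ring

lemma map_shiftBy {T S : Type*} {f : (ℤ → T) → ℤ → S} (hf : ∀ y, f (shift1 y) = shift1 (f y))
    (n : ℤ) (y : ℤ → T) : f (shiftBy n y) = shiftBy n (f y) := by
  have hinj : ∀ x z : ℤ → S, shift1 x = shift1 z → x = z := by
    intro x z h
    funext i
    simpa [shift1] using congrFun h (i - 1)
  induction n using Int.induction_on with
  | zero => rw [shiftBy_zero, shiftBy_zero]
  | succ n ih => rw [shiftBy_add_one, shiftBy_add_one, hf, ih]
  | pred n ih =>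
    apply hinj
    rw [← hf, ← shiftBy_add_one, ← shiftBy_add_one, sub_add_cancel, ih]

lemma occursW_shiftBy {S : Type*} (u : List S) (n : ℤ) (x : ℤ → S) :
    occursW u (shiftBy n x) → occursW u x := by
  rintro ⟨m, hm⟩
  refine ⟨m + n, fun i => ?_⟩
  rw [← hm i, shiftBy]
  congr 1
  ring

lemma IsSFT1.shiftBy_mem {S : Type*} {X : Set (ℤ → S)} (hX : IsSFT1 X) (n : ℤ) {x : ℤ → S}
    (hx : x ∈ X) : shiftBy n x ∈ X := by
  obtain ⟨F, -, rfl⟩ := hX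
  exact fun u hu h => hx u hu (occursW_shiftBy u n x h)

lemma IsSFT1.isClosed {S : Type*} [TopologicalSpace S] [DiscreteTopology S] {X : Set (ℤ → S)}
    (hX : IsSFT1 X) : IsClosed X := by
  obtain ⟨F, -, rfl⟩ := hX
  have : {x : ℤ → S | ∀ u ∈ F, ¬ occursW u x} =
      ⋂ u ∈ F, ⋂ n : ℤ, ⋃ i : Fin u.length, {x | x (n + (i : ℕ)) ≠ u.get i} := by
    ext x
    simp [occursW, occursAtW]
  rw [this]
  refine isClosed_biInter fun u _ => isClosed_iInter fun n => isClosed_iUnion_of_finite fun i => ?_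
  exact (isClosed_discrete ({u.get i}ᶜ : Set S)).preimage
    (f := fun x : ℤ → S => x (n + ((i : ℕ) : ℤ))) (continuous_apply _)

lemma IsSFT1.exists_splice {S : Type*} {X : Set (ℤ → S)} (hX : IsSFT1 X) :
    ∃ N : ℕ, ∀ M : ℕ, N ≤ M → ∀ x ∈ X, ∀ y ∈ X, (∀ i : ℤ, -M ≤ i → i < M → x i = y i) →
      (fun i : ℤ => if i < 0 then x i else y i) ∈ X := by
  obtain ⟨F, hF, rfl⟩ := hX
  refine ⟨hF.toFinset.sup List.length, fun M hM x hx y hy hxy u hu => ?_⟩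
  have hlen : u.length ≤ hF.toFinset.sup List.length :=
    Finset.le_sup (f := List.length) (by simpa using hu)
  rintro ⟨n, hn⟩
  by_cases hnM : -M ≤ n
  · refine hy u hu ⟨n, fun i => ?_⟩
    rw [← hn i]
    dsimp only
    split_ifs with h
    · exact (hxy _ (by omega) (by omega)).symm
    · rfl
  · refine hx u hu ⟨n, fun i => ?_⟩
    have hi := i.2
    rw [← hn i]
    dsimp only
    rw [if_pos (by omega)]

lemma IsSofic1.shiftBy_mem {S : Type*} [TopologicalSpace S] {X : Set (ℤ → S)} (hX : IsSofic1 X) :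
    ∀ n, ∀ x ∈ X, shiftBy n x ∈ X := by
  obtain ⟨T, _, Y, f, hY, -, hf, rfl⟩ := hX
  rintro n _ ⟨y, hy, rfl⟩
  exact ⟨shiftBy n y, hY.shiftBy_mem n hy, map_shiftBy hf n y⟩

lemma IsSofic1.isClosed {S : Type*} [TopologicalSpace S] [DiscreteTopology S] {X : Set (ℤ → S)}
    (hX : IsSofic1 X) : IsClosed X := by
  obtain ⟨T, _, Y, f, hY, hcont, -, rfl⟩ := hX
  let _ : TopologicalSpace T := ⊥
  have : DiscreteTopology T := ⟨rfl⟩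
  exact (hY.isClosed.isCompact.image hcont).isClosed

lemma IsSofic1.finite_range_followers {S : Type*} [TopologicalSpace S] [DiscreteTopology S]
    {X : Set (ℤ → S)} (hX : IsSofic1 X) : (Set.range (followers X)).Finite := by
  obtain ⟨T, _, Y, f, hY, hcont, hf, rfl⟩ := hX
  let _ : TopologicalSpace T := ⊥
  have : DiscreteTopology T := ⟨rfl⟩
  obtain ⟨k, hk⟩ := exists_window ((continuous_apply (0 : ℤ)).comp hcont)
  obtain ⟨N, hN⟩ := hY.exists_splice
  have hloc : ∀ (j : ℤ) (y z : ℤ → T), (∀ i, j - k ≤ i → i ≤ j + k → y i = z i) →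
      f y j = f z j := by
    intro j y z h
    have := hk (shiftBy j y) (shiftBy j z) fun i h1 h2 => h _ (by omega) (by omega)
    simpa [map_shiftBy hf, shiftBy] using this
  let M : ℕ := max N k
  let G : (ℤ → S) → Set (Finset.Ico (-M : ℤ) M → T) := fun x =>
    {p | ∃ y ∈ Y, (∀ i < 0, f y i = x i) ∧ ∀ i, p i = y i}
  have hG : ∀ x x', G x ⊆ G x' → followers (f '' Y) x ⊆ followers (f '' Y) x' := by
    rintro x x' h r ⟨y, hy, hyr⟩
    have hyr' : ∀ i, f y i = joinRay x r i := congrFun hyr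
    obtain ⟨y', hy', hyx', hyy'⟩ := h (a := fun i => y i)
      (⟨y, hy, fun i hi => by simp [hyr', joinRay, hi], fun _ => rfl⟩)
    have heq : ∀ i : ℤ, -M ≤ i → i < M → y' i = y i := fun i h1 h2 =>
      (hyy' ⟨i, Finset.mem_Ico.2 ⟨h1, h2⟩⟩).symm
    refine ⟨_, hN M (le_max_left _ _) y' hy' y hy heq, ?_⟩
    have hkM : k ≤ M := le_max_right _ _
    funext i
    by_cases hi : i < 0
    · rw [hloc i _ y', hyx' i hi, joinRay, if_pos hi]
      intro j h1 h2
      split_ifs with hj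
      · rfl
      · exact (heq j (by omega) (by omega)).symm
    · rw [hloc i _ y, hyr' i, joinRay, joinRay, if_neg hi, if_neg hi]
      intro j h1 h2
      split_ifs with hj
      · exact heq j (by omega) (by omega)
      · rfl
  have hfac : ∀ x x', G x = G x' → followers (f '' Y) x = followers (f '' Y) x' := fun x x' h =>
    (hG x x' h.le).antisymm (hG x' x h.ge)
  obtain ⟨c, hc⟩ := (Function.factorsThrough_iff _).1 (fun x x' h => hfac x x' h :
    Function.FactorsThrough (followers (f '' Y)) G)
  rw [hc]
  exact (Set.toFinite (Set.range c)).subset (Set.range_comp_subset_range G c)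

lemma periodicConf_periodic [Inhabited S] (u : List S) (m : ℤ) :
    Function.Periodic (periodicConf u) (m * u.length) := by
  intro i
  simp [periodicConf]

lemma Function.Periodic.eq_of_eqOn_Iio {x y : ℤ → S} {p q N : ℤ} (hp : 0 < p) (hq : 0 < q)
    (hx : Function.Periodic x p) (hy : Function.Periodic y q) (h : ∀ i < N, x i = y i) :
    x = y := by
  funext i
  have hx' := hx.int_mul (-(|i| + |N| + 1) * q)
  have hy' := hy.int_mul (-(|i| + |N| + 1) * p)
  have hlt : i + -(|i| + |N| + 1) * q * p < N := by
    have h1 : 1 ≤ q * p := Int.mul_pos hq hp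
    have h2 := le_abs_self i
    have h3 := neg_abs_le N
    nlinarith [abs_nonneg i, abs_nonneg N]
  rw [Int.cast_id] at hx' hy'
  rw [← hx', ← hy', show -(|i| + |N| + 1) * p * q = -(|i| + |N| + 1) * q * p by ring]
  exact h _ hlt

lemma Function.Periodic.eq_of_eqOn_Ici {x y : ℤ → S} {p q N : ℤ} (hp : 0 < p) (hq : 0 < q)
    (hx : Function.Periodic x p) (hy : Function.Periodic y q) (h : ∀ i, N ≤ i → x i = y i) :
    x = y := by
  have : (fun i => x (-i)) = fun i => y (-i) := by
    refine Function.Periodic.eq_of_eqOn_Iio (N := -N) hp hq ?_ ?_ fun i hi => h _ (by omega)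
    · intro i
      have := hx (-(i + p))
      simp only at this ⊢
      rw [← this]; congr 1; ring
    · intro i
      have := hy (-(i + q))
      simp only at this ⊢
      rw [← this]; congr 1; ring
  funext i
  simpa using congrFun this (-i)

/-- Two words are conjugate up to powers: their periodic configurations are shifts of each
other. -/
def PeriodicEquiv [Inhabited S] (u v : List S) : Prop :=
  ∃ k, periodicConf u = shiftBy k (periodicConf v)

lemma periodicEquiv_equivalence [Inhabited S] :
    Equivalence (PeriodicEquiv : List S → List S → Prop) where
  refl u := ⟨0, (shiftBy_zero _).symm⟩
  symm := by
    rintro u v ⟨k, h⟩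
    exact ⟨-k, by rw [h, shiftBy_shiftBy, neg_add_cancel, shiftBy_zero]⟩
  trans := by
    rintro u v w ⟨k, h⟩ ⟨l, h'⟩
    exact ⟨k + l, by rw [h, h', shiftBy_shiftBy]⟩

lemma shiftBy_periodicConf_periodic [Inhabited S] (u : List S) (k : ℤ) :
    Function.Periodic (shiftBy k (periodicConf u)) (u.length : ℤ) := by
  intro i
  have := periodicConf_periodic u 1 (i + k)
  simp only [shiftBy]
  rw [← this]
  congr 1
  ring

lemma periodicEquiv_of_eq [Inhabited S] {u v : List S} {k l : ℤ}
    (h : shiftBy k (periodicConf u) = shiftBy l (periodicConf v)) : PeriodicEquiv u v := by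
  refine ⟨-k + l, ?_⟩
  rw [← shiftBy_shiftBy, ← h, shiftBy_shiftBy, neg_add_cancel, shiftBy_zero]

lemma glue_apply [Inhabited S] {u u' : List S} (hu : u ≠ []) (w : List S) (i : ℤ) :
    glue u w u' i = if i < 0 then periodicConf u i else
      if i < w.length then w.getD i.toNat default else periodicConf u' (i - w.length) := by
  have hpos : 0 < u.length := List.length_pos_iff.2 hu
  unfold glue periodicConf
  split_ifs <;> first | omega | rfl | skip
  · obtain ⟨j, rfl⟩ : ∃ j : ℕ, i = w.length + j := ⟨i.toNat - w.length, by omega⟩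
    rw [add_sub_cancel_left, ← Int.natCast_mod, Int.toNat_natCast, ← Nat.cast_add,
      Int.toNat_natCast, Nat.add_sub_cancel_left]
  · congr 1
    have := Nat.mod_lt (i.natAbs - 1) hpos
    have hd := Nat.div_add_mod (i.natAbs - 1) u.length
    have : i = (u.length - 1 - ((i.natAbs - 1) % u.length : ℕ) : ℤ) +
        u.length * (-((i.natAbs - 1) / u.length : ℕ) - 1) := by
      have h' : ((u.length * ((i.natAbs - 1) / u.length) + (i.natAbs - 1) % u.length : ℕ) : ℤ)
        = (i.natAbs - 1 : ℕ) := by rw [hd]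
      push_cast at h' ⊢
      rw [mul_sub, mul_neg]
      omega
    rw [eq_comm]
    conv_lhs => rw [this, Int.add_mul_emod_self_left]
    rw [Int.emod_eq_of_lt (by omega) (by omega)]
    omega

lemma length_repWord (k : ℕ) (w : List S) : (repWord k w).length = k * w.length := by
  induction k with
  | zero => simp [repWord]
  | succ k ih => rw [repWord, List.length_append, ih]; ring

lemma getD_repWord [Inhabited S] (w : List S) (k j : ℕ) (h : j < k * w.length) :
    (repWord k w).getD j default = periodicConf w j := by
  induction k generalizing j with
  | zero => simp at h
  | succ k ih =>
    rw [repWord]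
    by_cases hj : j < w.length
    · rw [List.getD_append _ _ _ _ hj, periodicConf, Int.emod_eq_of_lt (by omega) (by omega)]
      simp
    · rw [List.getD_append_right _ _ _ _ (by omega), ih _ (by rw [add_mul] at h; omega),
        ← periodicConf_periodic w 1]
      congr 1
      omega

lemma eq_periodicConf_of_wordAt_eq_repWord [Inhabited S] {x : ℤ → S} {n : ℤ} {l k : ℕ}
    {w : List S} (h : wordAt x n l = repWord k w) {i : ℤ} (h1 : n ≤ i) (h2 : i < n + l) :
    x i = periodicConf w (i - n) := by
  have hl : l = k * w.length := by rw [← length_repWord, ← h, length_wordAt]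
  obtain ⟨j, rfl⟩ : ∃ j : ℕ, i = n + j := ⟨(i - n).toNat, by omega⟩
  rw [← getD_wordAt x n l j (by omega), h, getD_repWord _ _ _ (by omega)]
  congr 1
  ring

lemma exists_rephase_left [Inhabited S] {x : ℤ → S} {u c : List S} {n : ℤ} (hc : c ≠ [])
    (hx : ∀ i < n, x i = periodicConf u (i - n)) (h : PeriodicEquiv u c) :
    ∃ l : ℕ, l ≤ c.length ∧ ∀ i < n - l, x i = periodicConf c (i - (n - l)) := by
  obtain ⟨k, hk⟩ := h
  have hpos : 0 < c.length := List.length_pos_iff.2 hc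
  have h0 := Int.emod_nonneg k (b := c.length) (by omega)
  have h1 := Int.emod_lt_of_pos k (b := c.length) (by omega)
  refine ⟨(k % c.length).toNat, by omega, fun i hi => ?_⟩
  rw [hx i (by omega), hk, shiftBy, ← periodicConf_periodic c (k / c.length) (_ - _)]
  congr 1
  rw [Int.toNat_of_nonneg h0]
  linarith [Int.ediv_mul_add_emod k c.length]

lemma exists_rephase_right [Inhabited S] {x : ℤ → S} {u c : List S} {n : ℤ} (hc : c ≠ [])
    (hx : ∀ i, n ≤ i → x i = periodicConf u (i - n)) (h : PeriodicEquiv u c) :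
    ∃ l : ℕ, l ≤ c.length ∧ ∀ i, n + l ≤ i → x i = periodicConf c (i - (n + l)) := by
  obtain ⟨k, hk⟩ := h
  have hpos : 0 < c.length := List.length_pos_iff.2 hc
  have h0 := Int.emod_nonneg (-k) (b := c.length) (by omega)
  have h1 := Int.emod_lt_of_pos (-k) (b := c.length) (by omega)
  refine ⟨(-k % c.length).toNat, by omega, fun i hi => ?_⟩
  rw [hx i (by omega), hk, shiftBy, ← periodicConf_periodic c (-(-k / c.length)) (_ - _)]
  congr 1
  rw [Int.toNat_of_nonneg h0]
  linarith [Int.ediv_mul_add_emod (-k) c.length]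

/-- `W` is a product `u₁^{n₁} ⋯ u_k^{n_k}`, where `u₁, …, u_k` are the entries of `L`. -/
def IsPowerProduct (L : List (List S)) (W : List S) : Prop :=
  ∃ ns : List ℕ, ns.length = L.length ∧ midWord (L.map fun u => ([], u)) ns = W

lemma midWord_append {ps ps' : List (List S × List S)} {ns ns' : List ℕ}
    (h : ns.length = ps.length) :
    midWord (ps ++ ps') (ns ++ ns') = midWord ps ns ++ midWord ps' ns' := by
  induction ps generalizing ns with
  | nil => simp_all [midWord]
  | cons p ps ih =>
    cases ns with
    | nil => simp at h
    | cons k ns => simp [midWord, ih (ns := ns) (by simpa using h)]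

lemma IsPowerProduct.append {L L' : List (List S)} {W W' : List S} (h : IsPowerProduct L W)
    (h' : IsPowerProduct L' W') : IsPowerProduct (L ++ L') (W ++ W') := by
  obtain ⟨ns, hl, rfl⟩ := h
  obtain ⟨ns', hl', rfl⟩ := h'
  exact ⟨ns ++ ns', by simp [hl, hl'], by rw [List.map_append, midWord_append (by simpa)]⟩

lemma isPowerProduct_singleton (k : ℕ) (u : List S) : IsPowerProduct [u] (repWord k u) :=
  ⟨[k], rfl, by simp [midWord]⟩

lemma isPowerProduct_nil (L : List (List S)) : IsPowerProduct L [] := by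
  induction L with
  | nil => exact ⟨[], rfl, rfl⟩
  | cons u L ih => exact (isPowerProduct_singleton 0 u).append ih

lemma isPowerProduct_repWord {L : List (List S)} {u : List S} (hu : u ∈ L) (k : ℕ) :
    IsPowerProduct L (repWord k u) := by
  obtain ⟨s, t, rfl⟩ := List.append_of_mem hu
  simpa using (isPowerProduct_nil s).append
    ((isPowerProduct_singleton k u).append (isPowerProduct_nil t))

/-- `W` is a product of `n` power products of `L`. -/
def IsIteratedPowerProduct (L : List (List S)) (n : ℕ) (W : List S) : Prop :=
  IsPowerProduct (List.replicate n L).flatten W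

lemma IsIteratedPowerProduct.append {L : List (List S)} {n m : ℕ} {W W' : List S}
    (h : IsIteratedPowerProduct L n W) (h' : IsIteratedPowerProduct L m W') :
    IsIteratedPowerProduct L (n + m) (W ++ W') := by
  rw [IsIteratedPowerProduct, List.replicate_add, List.flatten_append]
  exact IsPowerProduct.append h h'

lemma isIteratedPowerProduct_repWord {L : List (List S)} {u : List S} (hu : u ∈ L) (k : ℕ) :
    IsIteratedPowerProduct L 1 (repWord k u) := by
  simpa [IsIteratedPowerProduct] using isPowerProduct_repWord hu k

lemma isIteratedPowerProduct_of_mem {L : List (List S)} {u : List S} (hu : u ∈ L) :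
    IsIteratedPowerProduct L 1 u := by
  simpa [repWord] using isIteratedPowerProduct_repWord hu 1

lemma IsIteratedPowerProduct.mono {L : List (List S)} {n m : ℕ} {W : List S}
    (h : IsIteratedPowerProduct L n W) (hnm : n ≤ m) : IsIteratedPowerProduct L m W := by
  obtain ⟨k, rfl⟩ := Nat.exists_eq_add_of_le hnm
  simpa using h.append (isPowerProduct_nil (List.replicate k L).flatten)

lemma occursWIn_of_wordDeriv_eq {X : Set (ℤ → S)} {x : ℤ → S} (hx : x ∈ X) {u : List S}
    (hu : wordDeriv (followers X x) u = followers X x) : occursWIn X u := by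
  obtain ⟨r, hr⟩ := nonempty_followers hx
  rw [← hu] at hr
  refine ⟨_, hr, 0, fun i => ?_⟩
  have hi : ¬ (i : ℤ) < 0 := by omega
  simp [joinRay, prependWord, hi]

/-- The word `w q` generates the loops at the follower set `q`, for all follower sets of
configurations of `X`. -/
def IsLoopGenerator (X : Set (ℤ → S)) (w : Set (ℕ → S) → List S) : Prop :=
  ∀ x ∈ X, wordDeriv (followers X x) (w (followers X x)) = followers X x ∧
    ∀ v, wordDeriv (followers X x) v = followers X x → ∃ k, v = repWord k (w (followers X x))

lemma exists_isLoopGenerator [Inhabited S] [TopologicalSpace S] {X : Set (ℤ → S)}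
    (hcl : IsClosed X) (hc : X.Countable) : ∃ w, IsLoopGenerator X w := by
  have h : ∀ q : Set (ℕ → S), ∃ w, q ∈ followers X '' X →
      wordDeriv q w = q ∧ ∀ v, wordDeriv q v = q → ∃ k, v = repWord k w := by
    intro q
    by_cases hq : q ∈ followers X '' X
    · obtain ⟨x, hx, rfl⟩ := hq
      obtain ⟨w, hw⟩ := exists_loop_generator fun u v hu hv =>
        append_comm_of_wordDeriv_eq (isClosed_followers hcl x) (nonempty_followers hx)
          (countable_followers hc x) hu hv
      exact ⟨w, fun _ => hw⟩
    · exact ⟨[], fun h => absurd h hq⟩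
  choose w hw using h
  exact ⟨w, fun x hx => hw _ ⟨x, hx, rfl⟩⟩

lemma IsLoopGenerator.exists_wordAt_eq {X : Set (ℤ → S)} {w : Set (ℕ → S) → List S}
    (hw : IsLoopGenerator X w) (hsh : ∀ n, ∀ x ∈ X, shiftBy n x ∈ X) {x : ℤ → S} (hx : x ∈ X)
    {n : ℤ} {l : ℕ} {q : Set (ℕ → S)} (h : followers X (shiftBy n x) = q)
    (h' : followers X (shiftBy (n + l) x) = q) : ∃ k, wordAt x n l = repWord k (w q) := by
  subst h
  exact (hw _ (hsh n x hx)).2 _ (by rw [← followers_shiftBy_add hsh, h'])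

lemma IsLoopGenerator.ne_nil {X : Set (ℤ → S)} {w : Set (ℕ → S) → List S}
    (hw : IsLoopGenerator X w) (hsh : ∀ n, ∀ x ∈ X, shiftBy n x ∈ X) {x : ℤ → S} (hx : x ∈ X)
    {n : ℤ} {l : ℕ} {q : Set (ℕ → S)} (h : followers X (shiftBy n x) = q)
    (h' : followers X (shiftBy (n + l) x) = q) (hl : 0 < l) : w q ≠ [] := by
  intro h0
  obtain ⟨k, hk⟩ := hw.exists_wordAt_eq hsh hx h h'
  have := congrArg List.length hk
  rw [length_wordAt, length_repWord, h0] at this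
  simp at this
  omega

lemma IsLoopGenerator.eq_periodicConf_right [Inhabited S] {X : Set (ℤ → S)}
    {w : Set (ℕ → S) → List S} (hw : IsLoopGenerator X w)
    (hsh : ∀ n, ∀ x ∈ X, shiftBy n x ∈ X) {x : ℤ → S} (hx : x ∈ X) {n : ℤ} {q : Set (ℕ → S)}
    (hn : followers X (shiftBy n x) = q)
    (hinf : ∀ N, ∃ m, N ≤ m ∧ followers X (shiftBy m x) = q) :
    w q ≠ [] ∧ ∀ i, n ≤ i → x i = periodicConf (w q) (i - n) := by
  have key : ∀ i, n ≤ i → ∃ l : ℕ, i < n + l ∧ followers X (shiftBy (n + l) x) = q := by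
    intro i hi
    obtain ⟨m, hm, hmq⟩ := hinf (i + 1)
    refine ⟨(m - n).toNat, by omega, ?_⟩
    rwa [show n + ((m - n).toNat : ℤ) = m by omega]
  constructor
  · obtain ⟨l, hl, hlq⟩ := key n le_rfl
    exact hw.ne_nil hsh hx hn hlq (by omega)
  · intro i hi
    obtain ⟨l, hl, hlq⟩ := key i hi
    obtain ⟨k, hk⟩ := hw.exists_wordAt_eq hsh hx hn hlq
    exact eq_periodicConf_of_wordAt_eq_repWord hk hi hl

lemma IsLoopGenerator.eq_periodicConf_left [Inhabited S] {X : Set (ℤ → S)}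
    {w : Set (ℕ → S) → List S} (hw : IsLoopGenerator X w)
    (hsh : ∀ n, ∀ x ∈ X, shiftBy n x ∈ X) {x : ℤ → S} (hx : x ∈ X) {n : ℤ} {q : Set (ℕ → S)}
    (hn : followers X (shiftBy n x) = q)
    (hinf : ∀ N, ∃ m, m ≤ N ∧ followers X (shiftBy m x) = q) :
    w q ≠ [] ∧ ∀ i < n, x i = periodicConf (w q) (i - n) := by
  have key : ∀ i < n, ∃ l : ℕ, n - l ≤ i ∧ followers X (shiftBy (n - l) x) = q := by
    intro i hi
    obtain ⟨m, hm, hmq⟩ := hinf i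
    refine ⟨(n - m).toNat, by omega, ?_⟩
    rwa [show n - ((n - m).toNat : ℤ) = m by omega]
  have hn' : ∀ l : ℕ, followers X (shiftBy (n - l + l) x) = q := by
    intro l; rwa [sub_add_cancel]
  constructor
  · obtain ⟨l, hl, hlq⟩ := key (n - 1) (by omega)
    exact hw.ne_nil hsh hx hlq (hn' l) (by omega)
  · intro i hi
    obtain ⟨l, hl, hlq⟩ := key i hi
    obtain ⟨k, hk⟩ := hw.exists_wordAt_eq hsh hx hlq (hn' l)
    rw [eq_periodicConf_of_wordAt_eq_repWord hk hl (by omega)]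
    have hlk : l = k * (w q).length := by rw [← length_repWord, ← hk, length_wordAt]
    rw [← periodicConf_periodic (w q) k (i - n)]
    congr 1
    rw [hlk]
    push_cast
    ring

lemma exists_last_int {P : ℤ → Prop} {n : ℤ} (hn : P n) (h : ¬ ∀ N, ∃ m, N ≤ m ∧ P m) :
    ∃ l : ℕ, P (n + l) ∧ ∀ m, n + l < m → ¬ P m := by
  push Not at h
  obtain ⟨N, hN⟩ := h
  obtain ⟨b, hb, hmax⟩ := Int.exists_greatest_of_bdd (P := P)
    ⟨N, fun z hz => by by_contra hlt; exact hN z (by omega) hz⟩ ⟨n, hn⟩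
  have := hmax n hn
  refine ⟨(b - n).toNat, by rwa [show n + ((b - n).toNat : ℤ) = b by omega], fun m hm hPm => ?_⟩
  have := hmax m hPm
  omega

lemma IsLoopGenerator.exists_right_decomposition [Inhabited S] {X : Set (ℤ → S)}
    {w : Set (ℕ → S) → List S} (hw : IsLoopGenerator X w)
    (hsh : ∀ n, ∀ x ∈ X, shiftBy n x ∈ X) {x : ℤ → S} (hx : x ∈ X) {L : List (List S)}
    (hL : ∀ n, wordAt x n 1 ∈ L) (hwL : ∀ y ∈ X, w (followers X y) ∈ L)
    (Q : Finset (Set (ℕ → S))) (n : ℤ) (hQ : ∀ m, n ≤ m → followers X (shiftBy m x) ∈ Q) :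
    ∃ l : ℕ, IsIteratedPowerProduct L (2 * Q.card) (wordAt x n l) ∧
      ∃ q ∈ followers X '' X, w q ≠ [] ∧
        ∀ i, n + l ≤ i → x i = periodicConf (w q) (i - (n + l)) := by
  classical
  induction hcard : Q.card generalizing Q n with
  | zero =>
    rw [Finset.card_eq_zero] at hcard
    simpa [hcard] using hQ n le_rfl
  | succ c ih =>
    by_cases hinf : ∀ N, ∃ m, N ≤ m ∧ followers X (shiftBy m x) = followers X (shiftBy n x)
    · obtain ⟨h1, h2⟩ := hw.eq_periodicConf_right hsh hx rfl hinf
      exact ⟨0, isPowerProduct_nil _, _, ⟨_, hsh n x hx, rfl⟩, h1, by simpa using h2⟩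
    · obtain ⟨l, hl, hlast⟩ := exists_last_int
        (P := fun m => followers X (shiftBy m x) = followers X (shiftBy n x)) rfl hinf
      obtain ⟨k, hk⟩ := hw.exists_wordAt_eq hsh hx rfl hl
      obtain ⟨l', hl', q, hq, hq0, hper⟩ :=
        ih (Q.erase (followers X (shiftBy n x))) (n + l + 1)
          (fun m hm => Finset.mem_erase.2 ⟨hlast m (by omega), hQ m (by omega)⟩)
          (by rw [Finset.card_erase_of_mem (hQ n le_rfl), hcard, Nat.add_sub_cancel])
      refine ⟨l + 1 + l', ?_, q, hq, hq0, ?_⟩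
      · rw [wordAt_add, wordAt_add, hk]
        push_cast
        rw [← add_assoc]
        have := ((isIteratedPowerProduct_repWord (hwL _ (hsh n x hx)) k).append
          (isIteratedPowerProduct_of_mem (hL (n + l)))).append
          hl'
        exact this.mono (by omega)
      · intro i hi
        push_cast at hi ⊢
        rw [hper i (by omega)]
        congr 1
        ring

lemma exists_frequently_left {α : Type*} {s : ℤ → α} (hs : (Set.range s).Finite) :
    ∃ n, ∀ N, ∃ m, m ≤ N ∧ s m = s n := by
  have : Finite (Set.range s) := hs
  obtain ⟨⟨_, n, rfl⟩, hn⟩ := Finite.exists_infinite_fiber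
    (fun k : ℕ => (⟨s (-k), Set.mem_range_self _⟩ : Set.range s))
  refine ⟨n, fun N => ?_⟩
  obtain ⟨k, hk, hNk⟩ := (Set.infinite_coe_iff.1 hn).exists_gt N.natAbs
  exact ⟨-k, by omega, congrArg Subtype.val hk⟩

lemma eq_glue [Inhabited S] {x : ℤ → S} {u u' : List S} (hu : u ≠ []) {n : ℤ} {l : ℕ}
    (h1 : ∀ i < n, x i = periodicConf u (i - n))
    (h2 : ∀ i, n + l ≤ i → x i = periodicConf u' (i - (n + l))) :
    x = fun i => glue u (wordAt x n l) u' (i + -n) := by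
  funext i
  rw [glue_apply hu, length_wordAt]
  split_ifs with h h'
  · rw [h1 i (by omega)]; congr 1
  · rw [getD_wordAt _ _ _ _ (by omega)]; congr 1; omega
  · rw [h2 i (by omega)]; congr 1; ring

/-- The configurations of `X` are built from a word of `P` on the left, a power product of `L`,
and a word of `P` on the right; no two words of `P` have the same periodic orbit. -/
lemma exists_finite_decomposition [Finite S] [Inhabited S] {X : Set (ℤ → S)}
    {w : Set (ℕ → S) → List S} (hw : IsLoopGenerator X w)
    (hsh : ∀ n, ∀ x ∈ X, shiftBy n x ∈ X) (hfin : (Set.range (followers X)).Finite) :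
    ∃ (P : Set (List S)) (L : List (List S)), P.Finite ∧
      (∀ u ∈ P, u ≠ [] ∧ occursWIn X u) ∧ (∀ u ∈ P, ∀ v ∈ P, PeriodicEquiv u v → u = v) ∧
      (∀ u ∈ L, occursWIn X u) ∧
      ∀ x ∈ X, ∃ u ∈ P, ∃ u' ∈ P, ∃ (k : ℤ) (W : List S), IsPowerProduct L W ∧
        x = fun i => glue u W u' (i + k) := by
  classical
  have hwocc : ∀ q ∈ followers X '' X, occursWIn X (w q) := by
    rintro _ ⟨x, hx, rfl⟩
    exact occursWIn_of_wordDeriv_eq hx (hw x hx).1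
  have hQfin : (followers X '' X).Finite := hfin.subset (Set.image_subset_range _ _)
  let B : Set (List S) := {u | u ∈ w '' (followers X '' X) ∧ u ≠ []}
  have hBfin : B.Finite := (hQfin.image w).subset fun u hu => hu.1
  let r : Setoid B := Setoid.comap Subtype.val ⟨PeriodicEquiv, periodicEquiv_equivalence⟩
  let c : B → List S := fun u => (Quotient.mk r u).out.1
  have hcB : ∀ u, c u ∈ B := fun u => (Quotient.mk r u).out.2
  have hequiv : ∀ u : B, PeriodicEquiv u (c u) := fun u =>
    periodicEquiv_equivalence.symm (Quotient.mk_out (s := r) u)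
  obtain ⟨K, hK⟩ := ((hQfin.image w).image List.length).bddAbove
  have hwK : ∀ q ∈ followers X '' X, (w q).length ≤ K := fun q hq => hK ⟨_, ⟨q, hq, rfl⟩, rfl⟩
  have hBK : ∀ u ∈ B, u.length ≤ K := fun u hu => hK ⟨u, hu.1, rfl⟩
  have hAfin : {u : List S | u.length ≤ K + 1 ∧ occursWIn X u}.Finite :=
    (List.finite_length_le S (K + 1)).subset fun u hu => hu.1
  let A : List (List S) := hAfin.toFinset.toList
  have hA : ∀ u, u ∈ A ↔ u.length ≤ K + 1 ∧ occursWIn X u := by simp [A]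
  have hwordA : ∀ x ∈ X, ∀ n l, l ≤ K + 1 → wordAt x n l ∈ A := fun x hx n l hl =>
    (hA _).2 ⟨by simpa using hl, x, hx, occursW_wordAt x n l⟩
  refine ⟨Set.range c, (List.replicate (1 + 2 * hfin.toFinset.card + 1) A).flatten, ?_, ?_, ?_,
    ?_, ?_⟩
  · exact hBfin.subset (Set.range_subset_iff.2 hcB)
  · rintro _ ⟨u, rfl⟩
    obtain ⟨⟨q, hq, hqu⟩, h0⟩ := hcB u
    exact ⟨h0, hqu ▸ hwocc q hq⟩
  · rintro _ ⟨u, rfl⟩ _ ⟨v, rfl⟩ h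
    have : Quotient.mk r u = Quotient.mk r v := Quotient.sound
      (periodicEquiv_equivalence.trans (hequiv u)
        (periodicEquiv_equivalence.trans h (periodicEquiv_equivalence.symm (hequiv v))))
    simp only [c, this]
  · intro u hu
    simp only [List.mem_flatten, List.mem_replicate] at hu
    obtain ⟨l, ⟨-, rfl⟩, hul⟩ := hu
    exact ((hA u).1 hul).2
  · intro x hx
    obtain ⟨n, hn⟩ := exists_frequently_left (s := fun n => followers X (shiftBy n x))
      (hfin.subset (by rintro _ ⟨n, rfl⟩; exact ⟨_, rfl⟩))
    obtain ⟨h0, hleft⟩ := hw.eq_periodicConf_left hsh hx rfl hn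
    obtain ⟨l, hprod, q, hq, hq0, hright⟩ := hw.exists_right_decomposition hsh hx
      (L := A) (fun n => hwordA x hx n 1 (by omega))
      (fun y hy => (hA _).2
        ⟨(hwK _ ⟨y, hy, rfl⟩).trans (Nat.le_succ K), hwocc _ ⟨y, hy, rfl⟩⟩)
      hfin.toFinset n (fun m _ => hfin.mem_toFinset.2 ⟨_, rfl⟩)
    have hq' : followers X (shiftBy n x) ∈ followers X '' X := ⟨_, hsh n x hx, rfl⟩
    let b : B := ⟨_, ⟨_, hq', rfl⟩, h0⟩
    let b' : B := ⟨_, ⟨_, hq, rfl⟩, hq0⟩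
    obtain ⟨j, hj, hleft'⟩ := exists_rephase_left (hcB b).2 hleft (hequiv b)
    obtain ⟨j', hj', hright'⟩ := exists_rephase_right (hcB b').2 hright (hequiv b')
    refine ⟨c b, ⟨b, rfl⟩, c b', ⟨b', rfl⟩, -(n - j), wordAt x (n - j) (j + l + j'), ?_,
      eq_glue (hcB b).2 hleft' ?_⟩
    · have hjK := hj.trans (hBK _ (hcB b))
      have hjK' := hj'.trans (hBK _ (hcB b'))
      rw [wordAt_add, wordAt_add, sub_add_cancel]
      exact ((isIteratedPowerProduct_of_mem (hwordA x hx _ j (by omega))).append hprod).append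
        (isIteratedPowerProduct_of_mem (hwordA x hx _ j' (by omega)))
    · have : n - j + ((j + l + j' : ℕ) : ℤ) = n + l + j' := by push_cast; ring
      rw [this]
      exact hright'

lemma glue_eq_periodicConf_left [Inhabited S] {u u' : List S} (hu : u ≠ []) (W : List S) {i : ℤ}
    (hi : i < 0) : glue u W u' i = periodicConf u i := by
  rw [glue_apply hu, if_pos hi]

lemma glue_eq_periodicConf_right [Inhabited S] {u u' : List S} (hu : u ≠ []) (W : List S) {i : ℤ}
    (hi : W.length ≤ i) : glue u W u' i = periodicConf u' (i - W.length) := by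
  rw [glue_apply hu, if_neg (by omega), if_neg (by omega)]

lemma periodicEquiv_of_glue_eq [Inhabited S] {u v u' v' : List S} (hu : u ≠ []) (hv : v ≠ [])
    (hu' : u' ≠ []) (hv' : v' ≠ []) {k l : ℤ} {W V : List S}
    (h : (fun i => glue u W u' (i + k)) = fun i => glue v V v' (i + l)) :
    PeriodicEquiv u v ∧ PeriodicEquiv u' v' := by
  have pos : ∀ {t : List S}, t ≠ [] → (0 : ℤ) < t.length := fun ht => by
    exact_mod_cast List.length_pos_iff.2 ht
  constructor
  · refine periodicEquiv_of_eq (k := k) (l := l) (Function.Periodic.eq_of_eqOn_Iio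
      (N := min (-k) (-l)) (pos hu) (pos hv) (shiftBy_periodicConf_periodic u k)
      (shiftBy_periodicConf_periodic v l) fun i hi => ?_)
    have := congrFun h i
    rwa [glue_eq_periodicConf_left hu _ (by omega),
      glue_eq_periodicConf_left hv _ (by omega)] at this
  · refine periodicEquiv_of_eq (k := k - W.length) (l := l - V.length)
      (Function.Periodic.eq_of_eqOn_Ici
      (N := max (W.length - k) (V.length - l)) (pos hu') (pos hv')
      (shiftBy_periodicConf_periodic u' _)
      (shiftBy_periodicConf_periodic v' _) fun i hi => ?_)
    have := congrFun h i
    rw [glue_eq_periodicConf_right hu _ (by omega),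
      glue_eq_periodicConf_right hv _ (by omega)] at this
    simpa only [shiftBy, add_sub_assoc] using this

lemma finite_shifts_periodicConf [Inhabited S] {u : List S} (hu : u ≠ []) :
    (Set.range fun k : ℤ => shiftBy k (periodicConf u)).Finite := by
  have hpos : 0 < u.length := List.length_pos_iff.2 hu
  refine ((Set.finite_Ico (0 : ℤ) u.length).image fun k => shiftBy k (periodicConf u)).subset ?_
  rintro _ ⟨k, rfl⟩
  refine ⟨k % u.length, ⟨Int.emod_nonneg _ (by omega), Int.emod_lt_of_pos _ (by omega)⟩, ?_⟩
  funext i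
  simp [shiftBy, periodicConf]

end

/-- Structure of countable sofic shifts: there is a finite set `T` of tuples
`(u₀, [(v₁,u₁),…,(v_{m-1},u_{m-1})], v_m, u_m)` of words occurring in `X` such that every
configuration of `X` is, for a unique tuple of `T`, a shift of
`∞u₀ v₁ u₁^{n₁} ⋯ u_{m-1}^{n_{m-1}} v_m u_m∞` for some exponents. In particular, `X` has only
finitely many periodic configurations. -/
theorem countable_sofic_structure {S : Type} [Fintype S] [Inhabited S] [TopologicalSpace S]
    [DiscreteTopology S] (X : Set (ℤ → S)) (hX : IsSofic1 X) (hc : X.Countable) :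
    (∃ T : Set (List S × List (List S × List S) × List S × List S), T.Finite ∧
      (∀ t ∈ T, occursWIn X t.1 ∧ occursWIn X t.2.2.1 ∧ occursWIn X t.2.2.2 ∧
        ∀ p ∈ t.2.1, occursWIn X p.1 ∧ occursWIn X p.2) ∧
      ∀ x ∈ X, ∃! t : List S × List (List S × List S) × List S × List S,
        t ∈ T ∧ t.1 ≠ [] ∧ t.2.2.2 ≠ [] ∧
        ∃ (k : ℤ) (ns : List ℕ), ns.length = t.2.1.length ∧
          x = fun i => glue t.1 (midWord t.2.1 ns ++ t.2.2.1) t.2.2.2 (i + k)) ∧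
    {x ∈ X | ∃ p : ℕ, 1 ≤ p ∧ ∀ i : ℤ, x (i + (p : ℤ)) = x i}.Finite := by
  obtain ⟨w, hw⟩ := exists_isLoopGenerator hX.isClosed hc
  obtain ⟨P, L, hPfin, hP, hPeq, hL, hdec⟩ :=
    exists_finite_decomposition hw hX.shiftBy_mem hX.finite_range_followers
  refine ⟨⟨(fun p : List S × List S => (p.1, L.map (fun u => ([], u)), [], p.2)) '' (P ×ˢ P),
    (hPfin.prod hPfin).image _, ?_, ?_⟩, ?_⟩
  · rintro _ ⟨⟨u, u'⟩, ⟨hu, hu'⟩, rfl⟩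
    have hnil : occursWIn X [] := by
      obtain ⟨x, hx, -⟩ := (hP u hu).2
      exact ⟨x, hx, 0, fun i => i.elim0⟩
    refine ⟨(hP u hu).2, hnil, (hP u' hu').2, fun p hp => ?_⟩
    obtain ⟨v, hv, rfl⟩ := List.mem_map.1 hp
    exact ⟨hnil, hL v hv⟩
  · intro x hx
    obtain ⟨u, hu, u', hu', k, _, ⟨ns, hns, rfl⟩, hxk⟩ := hdec x hx
    refine ⟨(u, L.map (fun u => ([], u)), [], u'),
      ⟨⟨(u, u'), ⟨hu, hu'⟩, rfl⟩, (hP u hu).1, (hP u' hu').1, k, ns, by simpa using hns,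
        by simpa using hxk⟩, ?_⟩
    rintro _ ⟨⟨⟨v, v'⟩, ⟨hv, hv'⟩, rfl⟩, -, -, l, ms, -, hxl⟩
    obtain ⟨h1, h2⟩ := periodicEquiv_of_glue_eq (hP v hv).1 (hP u hu).1 (hP v' hv').1
      (hP u' hu').1 (hxl.symm.trans hxk)
    rw [hPeq v hv u hu h1, hPeq v' hv' u' hu' h2]
  · refine (hPfin.biUnion fun u hu => finite_shifts_periodicConf (hP u hu).1).subset ?_
    rintro x ⟨hx, p, hp, hper⟩
    obtain ⟨u, hu, u', -, k, W, -, hxk⟩ := hdec x hx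
    have hu0 := (hP u hu).1
    refine Set.mem_biUnion hu ⟨k, ?_⟩
    have hpos : (0 : ℤ) < u.length := by exact_mod_cast List.length_pos_iff.2 hu0
    refine Function.Periodic.eq_of_eqOn_Iio (N := -k) hpos (q := p) (by omega)
      (shiftBy_periodicConf_periodic u k) hper fun i hi => ?_
    rw [hxk]
    exact (glue_eq_periodicConf_left hu0 W (by omega)).symm
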